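/- For every d ≥ 1 there is a constant A_d ≥ 0 such that for every non-empty bounded set E ⊂ ℝ^d, every 0 < θ ≤ 1, and every 0 < r < 1: θ·s_E(r^θ) ≤ s_E(r) ≤ d − (d − s_E(r^θ))·θ + A_d/log(1/r). -/

import Mathlib

open Set Metric Filter Topology MeasureTheory

noncomputable section

/-- Least number of open balls of radius `r` needed to cover `E`. -/
def coveringNumber {α : Type*} [PseudoMetricSpace α] (E : Set α) (r : ℝ) : ℕ :=
  sInf {n : ℕ | ∃ t : Finset α, t.card = n ∧ E ⊆ ⋃ x ∈ t, Metric.ball x r}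

/-- `s_E(r) = log N_r(E) / log (1/r)`. -/
def sFun {α : Type*} [PseudoMetricSpace α] (E : Set α) (r : ℝ) : ℝ :=
  Real.log (coveringNumber E r) / Real.log (1 / r)

/-- Lower box dimension. -/
def dimLB {α : Type*} [PseudoMetricSpace α] (E : Set α) : ℝ :=
  Filter.liminf (fun r => sFun E r) (nhdsWithin (0 : ℝ) (Set.Ioi 0))

/-- Upper box dimension. -/
def dimUB {α : Type*} [PseudoMetricSpace α] (E : Set α) : ℝ :=
  Filter.limsup (fun r => sFun E r) (nhdsWithin (0 : ℝ) (Set.Ioi 0))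

/-- Upper right Dini derivative. -/
def upperDini (g : ℝ → ℝ) (x : ℝ) : ℝ :=
  Filter.limsup (fun h => (g (x + h) - g x) / h) (nhdsWithin (0 : ℝ) (Set.Ioi 0))

/-- The class `𝒢(λ, α)`. -/
def GClass (lam alp : ℝ) : Set (ℝ → ℝ) :=
  {g | Continuous g ∧ (∀ x, g x ∈ Set.Icc lam alp) ∧
    ∀ x, upperDini g x ∈ Set.Icc (lam - g x) (alp - g x)}

/-- Asymptotic equivalence of two functions. -/
def AsympEquiv (f g : ℝ → ℝ) : Prop :=
  Filter.Tendsto (fun x => f x - g x) Filter.atTop (nhds 0)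

/-- `E` has covering class `g`. -/
def HasCoveringClass {α : Type*} [PseudoMetricSpace α] (E : Set α) (g : ℝ → ℝ) : Prop :=
  AsympEquiv (fun x => sFun E (Real.exp (-Real.exp x))) g

/-- Composition of the maps indexed by a finite word. -/
def compMaps {α : Type*} {I : Type*} (T : I → α → α) : List I → α → α
  | [] => id
  | i :: w => T i ∘ compMaps T w

/-- A conformal iterated function system on `ℝ^d` satisfying the open set condition
and the cone condition. -/
structure CIFS (d : ℕ) where
  /-- the compact seed set -/
  X : Set (EuclideanSpace ℝ (Fin d))
  /-- the countable index set -/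
  I : Type
  /-- the contractions -/
  S : I → EuclideanSpace ℝ (Fin d) → EuclideanSpace ℝ (Fin d)
  hXcompact : IsCompact X
  hXconn : IsConnected X
  hXint : (interior X).Nonempty
  hIcount : Countable I
  hInonempty : Nonempty I
  hSmaps : ∀ i, Set.MapsTo (S i) X X
  /-- the uniform contraction ratio -/
  c : ℝ
  hc0 : 0 < c
  hc1 : c < 1
  hcontr : ∀ i, ∀ x ∈ X, ∀ y ∈ X,
    (x ≠ y → 0 < dist (S i x) (S i y)) ∧ dist (S i x) (S i y) ≤ c * dist x y
  /-- the open connected set on which the maps extend conformally -/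
  V : Set (EuclideanSpace ℝ (Fin d))
  hVopen : IsOpen V
  hVbdd : Bornology.IsBounded V
  hVconn : IsConnected V
  hXV : X ⊆ V
  /-- the conformal extensions -/
  T : I → EuclideanSpace ℝ (Fin d) → EuclideanSpace ℝ (Fin d)
  hTagree : ∀ i, ∀ x ∈ X, T i x = S i x
  hTmaps : ∀ i, Set.MapsTo (T i) V V
  hTinj : ∀ i, Set.InjOn (T i) V
  /-- the Hölder exponent in `C^{1+ε}` -/
  eps : ℝ
  heps : 0 < eps
  hTdiff : ∀ i, ContDiffOn ℝ 1 (T i) V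
  hTholder : ∀ i, ∃ C : ℝ, 0 < C ∧ ∀ x ∈ V, ∀ y ∈ V,
    ‖fderiv ℝ (T i) x - fderiv ℝ (T i) y‖ ≤ C * ‖x - y‖ ^ eps
  hTconf : ∀ i, ∀ x ∈ V, IsConformalMap (fderiv ℝ (T i) x)
  /-- the bounded distortion constant -/
  K : ℝ
  hK : 1 ≤ K
  hBD : ∀ w : List I, ∀ x ∈ V, ∀ y ∈ V,
    ‖fderiv ℝ (compMaps T w) x‖ ≤ K * ‖fderiv ℝ (compMaps T w) y‖
  hOSCin : ∀ i, S i '' interior X ⊆ interior X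
  hOSCdisj : ∀ i j, i ≠ j → Disjoint (S i '' interior X) (S j '' interior X)
  hCone : ∃ κ : ℝ, 0 < κ ∧ ∀ x ∈ X, ∀ r : ℝ, 0 < r → r < 1 →
    ENNReal.ofReal (κ * r ^ d) ≤ volume (Metric.ball x r ∩ interior X)

/-- The limit set (attractor) of a CIFS. -/
def CIFS.limitSet {d : ℕ} (Φ : CIFS d) : Set (EuclideanSpace ℝ (Fin d)) :=
  ⋃ γ : ℕ → Φ.I, ⋂ n : ℕ, compMaps Φ.S (List.ofFn fun k : Fin (n + 1) => γ k) '' Φ.X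

/-- The set of fixed points of the maps of a CIFS. -/
def CIFS.fixedPoints {d : ℕ} (Φ : CIFS d) : Set (EuclideanSpace ℝ (Fin d)) :=
  {x | x ∈ Φ.X ∧ ∃ i, Φ.S i x = x}

/-- `ρ(w) = sup_{x ∈ X} ‖S'_w(x)‖`. -/
def CIFS.rho {d : ℕ} (Φ : CIFS d) (w : List Φ.I) : ℝ :=
  sSup ((fun x => ‖fderiv ℝ (compMaps Φ.T w) x‖) '' Φ.X)

/-- `Ψ(r, θ) = (1 - θ)·dim_H Λ + θ·s_F(r^θ)`. -/
def CIFS.Psi {d : ℕ} (Φ : CIFS d) (r θ : ℝ) : ℝ :=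
  (1 - θ) * (dimH Φ.limitSet).toReal + θ * sFun Φ.fixedPoints (r ^ θ)

/-- `ψ(r) = max_{θ ∈ [0,1]} Ψ(r,θ)` (which equals the supremum over `θ ∈ (0,1]`,
since `Ψ(r,0)` is defined as the limit of `Ψ(r,θ)` as `θ → 0⁺`). -/
def CIFS.psi {d : ℕ} (Φ : CIFS d) (r : ℝ) : ℝ :=
  sSup (Φ.Psi r '' Set.Ioc (0 : ℝ) 1)

/-- The interval `𝒟(h, s, t, α)`. -/
def Dset (h s t α : ℝ) : Set ℝ :=
  if t ≤ h then {h}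
  else Set.Icc (max h s) (h + (t - h) * (α - h) * s / (α * t - h * s))

/-- The quantity whose limit as `θ → 1⁻` is the quasi-Assouad dimension. -/
def quasiAssouadAux {α : Type*} [PseudoMetricSpace α] (E : Set α) (θ : ℝ) : ℝ :=
  sInf {t : ℝ | 0 ≤ t ∧ ∃ C : ℝ, 0 < C ∧ ∀ x ∈ E, ∀ r R : ℝ,
    0 < r → r ≤ R ^ (1 / θ) → R ^ (1 / θ) ≤ R → R < 1 →
    (coveringNumber (E ∩ Metric.ball x R) r : ℝ) ≤ C * (R / r) ^ t}

/-- The quasi-Assouad dimension. -/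
def dimqA {α : Type*} [PseudoMetricSpace α] (E : Set α) : ℝ :=
  Filter.limsup (quasiAssouadAux E) (nhdsWithin (1 : ℝ) (Set.Iio 1))

/-- The modified lower box dimension. -/
def dimLMB {α : Type*} [PseudoMetricSpace α] (K : Set α) : ℝ :=
  sInf {s : ℝ | ∃ C : ℕ → Set α, (K ⊆ ⋃ i, C i) ∧
    (∀ i, (C i).Nonempty ∧ Bornology.IsBounded (C i)) ∧ s = ⨆ i, dimLB (C i)}

/-- The unit cube `[0,1]^d`. -/
def unitCube (d : ℕ) : Set (EuclideanSpace ℝ (Fin d)) :=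
  {x | ∀ j, x j ∈ Set.Icc (0 : ℝ) 1}

/-- The basic similarity maps in the homogeneous Moran construction. -/
def moranMap (d : ℕ) (r : ℝ) (i : Fin d → Bool)
    (x : EuclideanSpace ℝ (Fin d)) : EuclideanSpace ℝ (Fin d) :=
  (EuclideanSpace.equiv (Fin d) ℝ).symm (fun j => r * x j + (if i j then 1 - r else 0))

/-- The `n`-th level of the homogeneous Moran construction. -/
def moranLevel (d : ℕ) : (ℕ → ℝ) → ℕ → Set (EuclideanSpace ℝ (Fin d))
  | _, 0 => unitCube d
  | r, n + 1 => ⋃ i : Fin d → Bool, moranMap d (r 1) i '' moranLevel d (fun k => r (k + 1)) n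

/-- The homogeneous Moran set `M(r)`. -/
def moranSet (d : ℕ) (r : ℕ → ℝ) : Set (EuclideanSpace ℝ (Fin d)) :=
  ⋂ n, moranLevel d r (n + 1)

/-- The Gauss map `x ↦ 1/x - ⌊1/x⌋`. -/
def gaussMap (x : ℝ) : ℝ := Int.fract (1 / x)

/-- The `n`-th partial quotient (continued fraction digit) of `x` (`n = 0` gives `b₁ = ⌊1/x⌋`). -/
def cfDigit (x : ℝ) (n : ℕ) : ℤ := ⌊1 / gaussMap^[n] x⌋

/-- The set of irrationals in `(0,1)` all of whose continued fraction digits lie in `I`. -/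
def cfSet (I : Set ℕ) : Set ℝ :=
  {x | x ∈ Set.Ioo (0 : ℝ) 1 ∧ Irrational x ∧ ∀ n : ℕ, ∃ b ∈ I, cfDigit x n = (b : ℤ)}


/-- A volume bound: an `r`-separated finite subset of a ball of radius `R ≥ r` has at most
`(3 R / r) ^ dim` elements. -/
theorem card_le_of_pairwise_dist_ge {V : Type*} [NormedAddCommGroup V] [NormedSpace ℝ V]
    [FiniteDimensional ℝ V] {x : V} {r R : ℝ} (hr : 0 < r) (hrR : r ≤ R) {s : Finset V}
    (hsx : (s : Set V) ⊆ Metric.ball x R)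
    (hs : (s : Set V).Pairwise fun a b => r ≤ dist a b) :
    (s.card : ℝ) ≤ (3 * R / r) ^ Module.finrank ℝ V := by
  borelize V
  let μ : Measure V := Measure.addHaar
  have hδ : 0 < r / 2 := by positivity
  have hρ : 0 < R + r / 2 := by linarith
  have hdisj : (s : Set V).PairwiseDisjoint fun c => Metric.ball c (r / 2) := by
    intro a ha b hb hab
    apply Metric.ball_disjoint_ball
    simpa using hs ha hb hab
  have hsub : (⋃ c ∈ s, Metric.ball c (r / 2)) ⊆ Metric.ball x (R + r / 2) := by
    refine iUnion₂_subset fun c hc => Metric.ball_subset_ball' ?_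
    have := Metric.mem_ball.1 (hsx hc)
    linarith
  have hvol : (s.card : ENNReal) * ENNReal.ofReal ((r / 2) ^ Module.finrank ℝ V) *
      μ (Metric.ball 0 1) ≤
      ENNReal.ofReal ((R + r / 2) ^ Module.finrank ℝ V) * μ (Metric.ball 0 1) :=
    calc
      _ = μ (⋃ c ∈ s, Metric.ball c (r / 2)) := by
        rw [measure_biUnion_finset hdisj fun c _ => measurableSet_ball]
        simp only [μ.addHaar_ball_of_pos _ hδ, Finset.sum_const, nsmul_eq_mul, mul_assoc]
      _ ≤ μ (Metric.ball x (R + r / 2)) := measure_mono hsub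
      _ = _ := μ.addHaar_ball_of_pos _ hρ
  have hcard : (s.card : ENNReal) * ENNReal.ofReal ((r / 2) ^ Module.finrank ℝ V) ≤
      ENNReal.ofReal ((R + r / 2) ^ Module.finrank ℝ V) :=
    (ENNReal.mul_le_mul_iff_left (measure_ball_pos _ _ zero_lt_one).ne'
      measure_ball_lt_top.ne).1 hvol
  have hreal : (s.card : ℝ) * (r / 2) ^ Module.finrank ℝ V ≤
      (R + r / 2) ^ Module.finrank ℝ V := by
    have := ENNReal.toReal_le_of_le_ofReal (pow_nonneg hρ.le _) hcard
    rwa [ENNReal.toReal_mul, ENNReal.toReal_natCast,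
      ENNReal.toReal_ofReal (pow_nonneg hδ.le _)] at this
  refine le_of_mul_le_mul_right (hreal.trans ?_) (pow_pos hδ (Module.finrank ℝ V))
  rw [← mul_pow]
  refine pow_le_pow_left₀ hρ.le ?_ _
  have : 3 * R / r * (r / 2) = 3 * R / 2 := by field_simp
  linarith

/-- A ball of radius `R` is covered by at most `(3 R / r) ^ dim` balls of radius `r ≤ R`. -/
theorem exists_finset_ball_subset_biUnion_ball {V : Type*} [NormedAddCommGroup V]
    [NormedSpace ℝ V] [FiniteDimensional ℝ V] (x : V) {r R : ℝ} (hr : 0 < r) (hrR : r ≤ R) :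
    ∃ t : Finset V, (t.card : ℝ) ≤ (3 * R / r) ^ Module.finrank ℝ V ∧
      Metric.ball x R ⊆ ⋃ y ∈ t, Metric.ball y r := by
  classical
  let P : Set ℕ := {n | ∃ s : Finset V, s.card = n ∧ (s : Set V) ⊆ Metric.ball x R ∧
    (s : Set V).Pairwise fun a b => r ≤ dist a b}
  have hP : P.Nonempty := ⟨0, ∅, by simp⟩
  have hbdd : BddAbove P := by
    refine ⟨⌊(3 * R / r) ^ Module.finrank ℝ V⌋₊, ?_⟩
    rintro _ ⟨s, rfl, hsx, hs⟩
    exact Nat.le_floor (card_le_of_pairwise_dist_ge hr hrR hsx hs)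
  obtain ⟨t, htcard, htx, ht⟩ := Nat.sSup_mem hP hbdd
  refine ⟨t, card_le_of_pairwise_dist_ge hr hrR htx ht, fun y hy => ?_⟩
  by_contra hyt
  simp only [mem_iUnion, Metric.mem_ball, not_exists, not_lt] at hyt
  have hynot : y ∉ t := fun h => by
    have := hyt y h
    rw [dist_self] at this
    linarith
  have hmem : t.card + 1 ∈ P := by
    refine ⟨insert y t, Finset.card_insert_of_notMem hynot, ?_, ?_⟩
    · rw [Finset.coe_insert]
      exact insert_subset hy htx
    · rw [Finset.coe_insert]
      refine ht.insert fun b hb _ => ⟨hyt b hb, ?_⟩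
      rw [dist_comm]
      exact hyt b hb
  have := le_csSup hbdd hmem
  omega

theorem coveringNumber_le_card {α : Type*} [PseudoMetricSpace α] {E : Set α} {r : ℝ}
    {t : Finset α} (h : E ⊆ ⋃ x ∈ t, Metric.ball x r) : _root_.coveringNumber E r ≤ t.card :=
  Nat.sInf_le ⟨t, rfl, h⟩

theorem exists_card_eq_coveringNumber {α : Type*} [PseudoMetricSpace α] [ProperSpace α]
    {E : Set α} (hE : Bornology.IsBounded E) {r : ℝ} (hr : 0 < r) :
    ∃ t : Finset α, t.card = _root_.coveringNumber E r ∧ E ⊆ ⋃ x ∈ t, Metric.ball x r := by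
  obtain ⟨t, ht, hcov⟩ := Metric.totallyBounded_iff.1 (hE.isCompact_closure.totallyBounded.subset subset_closure) r hr
  refine Nat.sInf_mem
    (s := {n : ℕ | ∃ t : Finset α, t.card = n ∧ E ⊆ ⋃ x ∈ t, Metric.ball x r})
    ⟨_, ht.toFinset, rfl, ?_⟩
  simpa using hcov

theorem coveringNumber_pos {α : Type*} [PseudoMetricSpace α] [ProperSpace α]
    {E : Set α} (hne : E.Nonempty) (hE : Bornology.IsBounded E) {r : ℝ} (hr : 0 < r) :
    0 < _root_.coveringNumber E r := by
  obtain ⟨t, ht, hcov⟩ := exists_card_eq_coveringNumber hE hr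
  obtain ⟨x, hx⟩ := hne
  obtain ⟨y, hy, -⟩ := mem_iUnion₂.1 (hcov hx)
  rw [← ht]
  exact Finset.card_pos.2 ⟨y, hy⟩

theorem coveringNumber_le_of_le {α : Type*} [PseudoMetricSpace α] [ProperSpace α]
    {E : Set α} (hE : Bornology.IsBounded E) {r R : ℝ} (hr : 0 < r) (hrR : r ≤ R) :
    _root_.coveringNumber E R ≤ _root_.coveringNumber E r := by
  obtain ⟨t, ht, hcov⟩ := exists_card_eq_coveringNumber hE hr
  rw [← ht]
  exact coveringNumber_le_card
    (hcov.trans (iUnion₂_mono fun x _ => Metric.ball_subset_ball hrR))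

theorem coveringNumber_le_pow_mul {V : Type*} [NormedAddCommGroup V] [NormedSpace ℝ V]
    [FiniteDimensional ℝ V] {E : Set V} (hE : Bornology.IsBounded E) {r R : ℝ}
    (hr : 0 < r) (hrR : r ≤ R) :
    (_root_.coveringNumber E r : ℝ) ≤
      (3 * R / r) ^ Module.finrank ℝ V * _root_.coveringNumber E R := by
  classical
  have := FiniteDimensional.proper_real V
  obtain ⟨t, ht, hcov⟩ := exists_card_eq_coveringNumber hE (hr.trans_le hrR)
  choose f hfcard hfcov using
    fun x : V => exists_finset_ball_subset_biUnion_ball x hr hrR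
  have hsub : E ⊆ ⋃ y ∈ t.biUnion f, Metric.ball y r := by
    intro z hz
    obtain ⟨x, hx, hzx⟩ := mem_iUnion₂.1 (hcov hz)
    obtain ⟨y, hy, hzy⟩ := mem_iUnion₂.1 (hfcov x hzx)
    exact mem_iUnion₂.2 ⟨y, Finset.mem_biUnion.2 ⟨x, hx, hy⟩, hzy⟩
  calc (_root_.coveringNumber E r : ℝ) ≤ ((t.biUnion f).card : ℝ) :=
        mod_cast coveringNumber_le_card hsub
    _ ≤ ∑ x ∈ t, ((f x).card : ℝ) := mod_cast Finset.card_biUnion_le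
    _ ≤ ∑ _x ∈ t, (3 * R / r) ^ Module.finrank ℝ V := Finset.sum_le_sum fun x _ => hfcard x
    _ = (3 * R / r) ^ Module.finrank ℝ V * _root_.coveringNumber E R := by
        rw [Finset.sum_const, nsmul_eq_mul, ht, mul_comm]

/-- For every `d ≥ 1` there is `A_d ≥ 0` such that for every non-empty
bounded `E ⊆ ℝ^d`, every `0 < θ ≤ 1` and every `0 < r < 1`:
`θ·s_E(r^θ) ≤ s_E(r) ≤ d - (d - s_E(r^θ))·θ + A_d / log(1/r)`. -/
theorem covering_regularity {d : ℕ} (hd : 1 ≤ d) :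
    ∃ A : ℝ, 0 ≤ A ∧ ∀ E : Set (EuclideanSpace ℝ (Fin d)), E.Nonempty →
      Bornology.IsBounded E → ∀ θ r : ℝ, 0 < θ → θ ≤ 1 → 0 < r → r < 1 →
        θ * sFun E (r ^ θ) ≤ sFun E r ∧
        sFun E r ≤ (d : ℝ) - ((d : ℝ) - sFun E (r ^ θ)) * θ + A / Real.log (1 / r) := by
  refine ⟨d * Real.log 3, mul_nonneg (Nat.cast_nonneg d) (Real.log_nonneg (by norm_num)), ?_⟩
  intro E hne hE θ r hθ hθ1 hr hr1
  have hL : 0 < Real.log (1 / r) := Real.log_pos ((one_lt_div hr).2 hr1)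
  have hR : 0 < r ^ θ := Real.rpow_pos_of_pos hr θ
  have hrR : r ≤ r ^ θ := by
    simpa using Real.rpow_le_rpow_of_exponent_ge hr hr1.le hθ1
  have hNr : (0 : ℝ) < _root_.coveringNumber E r := mod_cast coveringNumber_pos hne hE hr
  have hNR : (0 : ℝ) < _root_.coveringNumber E (r ^ θ) := mod_cast coveringNumber_pos hne hE hR
  have hlogR : Real.log (1 / r ^ θ) = θ * Real.log (1 / r) := by
    rw [one_div, one_div, Real.log_inv, Real.log_inv, Real.log_rpow hr]
    ring
  have hθs : θ * sFun E (r ^ θ) =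
      Real.log (_root_.coveringNumber E (r ^ θ)) / Real.log (1 / r) := by
    rw [sFun, hlogR]
    field_simp
  have hlower : Real.log (_root_.coveringNumber E (r ^ θ)) ≤
      Real.log (_root_.coveringNumber E r) :=
    Real.log_le_log hNR (mod_cast coveringNumber_le_of_le hE hr hrR)
  have hupper : Real.log (_root_.coveringNumber E r) ≤
      d * (Real.log 3 + (1 - θ) * Real.log (1 / r)) +
        Real.log (_root_.coveringNumber E (r ^ θ)) := by
    have h := Real.log_le_log hNr (coveringNumber_le_pow_mul hE hr hrR)
    rw [finrank_euclideanSpace_fin, Real.log_mul (by positivity) hNR.ne', Real.log_pow,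
      Real.log_div (by positivity) hr.ne', Real.log_mul (by norm_num) hR.ne',
      Real.log_rpow hr] at h
    rw [one_div, Real.log_inv]
    linarith
  refine ⟨?_, ?_⟩
  · rw [hθs, sFun]
    exact div_le_div_of_nonneg_right hlower hL.le
  · have hrhs : (d : ℝ) - ((d : ℝ) - sFun E (r ^ θ)) * θ + d * Real.log 3 / Real.log (1 / r) =
        (d * (Real.log 3 + (1 - θ) * Real.log (1 / r)) +
          Real.log (_root_.coveringNumber E (r ^ θ))) / Real.log (1 / r) := by
      rw [sub_mul, mul_comm (sFun E (r ^ θ)), hθs]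
      field_simp
      ring
    rw [hrhs, sFun]
    exact div_le_div_of_nonneg_right hupper hL.le

end
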